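/- (Certification in the flow domain.) Let F be any function on ℝ^{nm} (a classifier), R a probability distribution on the n×m pixel grid, μ a probability distribution on the grid, δ^μ any flow with Δ(R, δ^μ) = μ, and ε > 0. Define F̃(δ) := F(Δ(R, δ)). If F̃(δ) = F̃(δ^μ) for every flow δ with ‖δ − δ^μ‖₁ < ε, then F(ν) = F(μ) for every probability distribution ν with W₁(μ, ν) < ε. -/

import Mathlib

namespace WassersteinFlow

/-- A flow on the `n × m` grid: a pair `(δ→, δ↓)` with `δ→ ∈ ℝ^{n×(m-1)}`
and `δ↓ ∈ ℝ^{(n-1)×m}`. -/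
abbrev Flow (n m : ℕ) := (Fin n → Fin (m - 1) → ℝ) × (Fin (n - 1) → Fin m → ℝ)

/-- Entry access with out-of-range indices giving `0` (0-based indices). -/
def entry {a b : ℕ} (δ : Fin a → Fin b → ℝ) (i j : ℤ) : ℝ :=
  if h : 0 ≤ i ∧ i < (a : ℤ) ∧ 0 ≤ j ∧ j < (b : ℤ) then
    δ ⟨i.toNat, by omega⟩ ⟨j.toNat, by omega⟩
  else 0

/-- The flow application map `Δ`:
`Δ(μ,δ)_{i,j} = μ_{i,j} + δ↓_{i−1,j} + δ→_{i,j−1} − δ↓_{i,j} − δ→_{i,j}`,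
with out-of-range entries taken to be `0`. -/
def applyFlow {n m : ℕ} (μ : Fin n × Fin m → ℝ) (δ : Flow n m) : Fin n × Fin m → ℝ :=
  fun x =>
    μ x + entry δ.2 ((x.1 : ℤ) - 1) (x.2 : ℤ) + entry δ.1 (x.1 : ℤ) ((x.2 : ℤ) - 1)
      - entry δ.2 (x.1 : ℤ) (x.2 : ℤ) - entry δ.1 (x.1 : ℤ) (x.2 : ℤ)

/-- The `L¹`-norm of a flow: the sum of absolute values of all entries. -/
def flowL1 {n m : ℕ} (δ : Flow n m) : ℝ :=
  (∑ i, ∑ j, |δ.1 i j|) + (∑ i, ∑ j, |δ.2 i j|)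

/-- A probability distribution on the grid. -/
def IsProbDist {n m : ℕ} (μ : Fin n × Fin m → ℝ) : Prop :=
  (∀ x, 0 ≤ μ x) ∧ ∑ x, μ x = 1

/-- The `L¹` ground metric `d((i,j),(k,l)) = |i−k| + |j−l|` on the grid. -/
def gd {n m : ℕ} (x y : Fin n × Fin m) : ℝ :=
  ((|(x.1 : ℤ) - (y.1 : ℤ)| + |(x.2 : ℤ) - (y.2 : ℤ)| : ℤ) : ℝ)

/-- `π` is a coupling of `μ` and `ν`. -/
def IsCoupling {n m : ℕ} (μ ν : Fin n × Fin m → ℝ)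
    (π : (Fin n × Fin m) × (Fin n × Fin m) → ℝ) : Prop :=
  (∀ p, 0 ≤ π p) ∧ (∀ x, ∑ y, π (x, y) = μ x) ∧ (∀ y, ∑ x, π (x, y) = ν y)

/-- The 1-Wasserstein distance with `L¹` ground metric. -/
noncomputable def W1 {n m : ℕ} (μ ν : Fin n × Fin m → ℝ) : ℝ :=
  sInf {c | ∃ π, IsCoupling μ ν π ∧
    c = ∑ p : (Fin n × Fin m) × (Fin n × Fin m), gd p.1 p.2 * π p}

/-- Index type for flattened flows. -/
abbrev FlowIdx (n m : ℕ) := (Fin n × Fin (m - 1)) ⊕ (Fin (n - 1) × Fin m)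

/-- Flatten a flow to a vector in `ℝ^{n(m−1)+(n−1)m}`. -/
def flat {n m : ℕ} (δ : Flow n m) : FlowIdx n m → ℝ :=
  Sum.elim (fun p => δ.1 p.1 p.2) (fun p => δ.2 p.1 p.2)

theorem entry_add {a b : ℕ} (δ δ' : Fin a → Fin b → ℝ) (i j : ℤ) :
    entry (δ + δ') i j = entry δ i j + entry δ' i j := by
  unfold entry
  split_ifs <;> simp

theorem entry_sum_smul {ι : Type*} {a b : ℕ} (s : Finset ι) (c : ι → ℝ)
    (δ : ι → Fin a → Fin b → ℝ) (i j : ℤ) :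
    entry (∑ p ∈ s, c p • δ p) i j = ∑ p ∈ s, c p * entry (δ p) i j := by
  unfold entry
  split_ifs <;> simp [Finset.sum_apply]

theorem applyFlow_add_sum_smul {ι : Type*} {n m : ℕ} (μ : Fin n × Fin m → ℝ) (δ : Flow n m)
    (s : Finset ι) (c : ι → ℝ) (φ : ι → Flow n m) (z : Fin n × Fin m) :
    applyFlow μ (δ + ∑ p ∈ s, c p • φ p) z =
      applyFlow μ δ z + ∑ p ∈ s, c p * applyFlow 0 (φ p) z := by
  simp only [applyFlow, Prod.fst_add, Prod.snd_add, Prod.fst_sum, Prod.snd_sum, Prod.smul_fst,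
    Prod.smul_snd, entry_add, entry_sum_smul, Pi.zero_apply, zero_add, mul_add, mul_sub,
    Finset.sum_add_distrib, Finset.sum_sub_distrib]
  ring

theorem flowL1_zero {n m : ℕ} : flowL1 (0 : Flow n m) = 0 := by
  simp [flowL1]

theorem flowL1_add_le {n m : ℕ} (δ δ' : Flow n m) :
    flowL1 (δ + δ') ≤ flowL1 δ + flowL1 δ' := by
  have h : flowL1 δ + flowL1 δ' = (∑ i, ∑ j, (|δ.1 i j| + |δ'.1 i j|)) +
      ∑ i, ∑ j, (|δ.2 i j| + |δ'.2 i j|) := by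
    simp only [flowL1, Finset.sum_add_distrib]
    ring
  rw [h, flowL1]
  gcongr <;> exact abs_add_le _ _

theorem flowL1_smul {n m : ℕ} (c : ℝ) (δ : Flow n m) : flowL1 (c • δ) = |c| * flowL1 δ := by
  simp [flowL1, abs_mul, Finset.mul_sum, mul_add]

theorem flowL1_sum_smul_le {ι : Type*} {n m : ℕ} (s : Finset ι) (c : ι → ℝ)
    (φ : ι → Flow n m) :
    flowL1 (∑ p ∈ s, c p • φ p) ≤ ∑ p ∈ s, |c p| * flowL1 (φ p) := by
  simp only [← flowL1_smul]
  exact Finset.le_sum_of_subadditive _ flowL1_zero.le flowL1_add_le _ _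

/-- The signed indicator of the integer interval between `i` and `k`. -/
def crossing (i k a : ℤ) : ℝ := (if i ≤ a then 1 else 0) - (if k ≤ a then 1 else 0)

theorem crossing_sub_one_sub (i k a : ℤ) :
    crossing i k (a - 1) - crossing i k a =
      (if a = k then 1 else 0) - (if a = i then 1 else 0) := by
  have h (t : ℤ) : (if t ≤ a then (1 : ℝ) else 0) =
      (if t ≤ a - 1 then 1 else 0) + (if a = t then 1 else 0) := by
    split_ifs <;> first | omega | norm_num
  rw [crossing, crossing, h i, h k]
  ring

theorem sum_abs_crossing_le (N i k : ℕ) :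
    ∑ a : Fin N, |crossing i k (a : ℕ)| ≤ ((|(i : ℤ) - k| : ℤ) : ℝ) := by
  have h (a : ℕ) : |crossing i k a| = if a ∈ Finset.Ico (min i k) (max i k) then 1 else 0 := by
    simp only [crossing, Finset.mem_Ico]
    split_ifs <;> first | omega | norm_num
  simp only [h]
  rw [Fin.sum_univ_eq_sum_range
    (fun a => if a ∈ Finset.Ico (min i k) (max i k) then (1 : ℝ) else 0), Finset.sum_boole]
  have hcard : ((Finset.range N).filter (· ∈ Finset.Ico (min i k) (max i k))).card ≤
      max i k - min i k := by
    rw [← Nat.card_Ico]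
    exact Finset.card_le_card fun a ha => (Finset.mem_filter.1 ha).2
  have : ((((Finset.range N).filter (· ∈ Finset.Ico (min i k) (max i k))).card : ℕ) : ℤ) ≤
      |(i : ℤ) - k| := by
    rcases abs_cases ((i : ℤ) - k) with h | h <;> omega
  exact_mod_cast this

/-- The unit flow that moves mass from `x` to `y`, first along the column of `x` and then along
the row of `y`. -/
def pathFlow {n m : ℕ} (x y : Fin n × Fin m) : Flow n m :=
  (fun a b => if a = y.1 then crossing (x.2 : ℕ) (y.2 : ℕ) (b : ℕ) else 0,
   fun a b => if b = x.2 then crossing (x.1 : ℕ) (y.1 : ℕ) (a : ℕ) else 0)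

theorem entry_pathFlow_fst {n m : ℕ} (x y : Fin n × Fin m) (a : Fin n) (b : ℤ)
    (hb : -1 ≤ b) (hb' : b < m) :
    entry (pathFlow x y).1 (a : ℕ) b =
      if a = y.1 then crossing (x.2 : ℕ) (y.2 : ℕ) b else 0 := by
  have := x.2.isLt
  have := y.2.isLt
  by_cases h : 0 ≤ b ∧ b < (m - 1 : ℕ)
  · rw [entry, dif_pos ⟨by omega, by omega, h⟩]
    simp [pathFlow, h.1]
  · rw [entry, dif_neg (by tauto), crossing]
    split_ifs <;> first | omega | norm_num

theorem entry_pathFlow_snd {n m : ℕ} (x y : Fin n × Fin m) (a : ℤ) (b : Fin m)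
    (ha : -1 ≤ a) (ha' : a < n) :
    entry (pathFlow x y).2 a (b : ℕ) =
      if b = x.2 then crossing (x.1 : ℕ) (y.1 : ℕ) a else 0 := by
  have := x.1.isLt
  have := y.1.isLt
  by_cases h : 0 ≤ a ∧ a < (n - 1 : ℕ)
  · rw [entry, dif_pos ⟨h.1, h.2, by omega, by omega⟩]
    simp [pathFlow, h.1]
  · rw [entry, dif_neg (by tauto), crossing]
    split_ifs <;> first | omega | norm_num

theorem applyFlow_zero_pathFlow {n m : ℕ} (x y z : Fin n × Fin m) :
    applyFlow 0 (pathFlow x y) z = (if z = y then 1 else 0) - (if z = x then 1 else 0) := by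
  have h₁ := z.1.isLt
  have h₂ := z.2.isLt
  have hv := crossing_sub_one_sub (x.1 : ℕ) (y.1 : ℕ) (z.1 : ℕ)
  have hh := crossing_sub_one_sub (x.2 : ℕ) (y.2 : ℕ) (z.2 : ℕ)
  simp only [Nat.cast_inj, Fin.val_inj] at hv hh
  rw [applyFlow, entry_pathFlow_fst _ _ _ _ (by omega) (by omega),
    entry_pathFlow_fst _ _ _ _ (by omega) (by omega),
    entry_pathFlow_snd _ _ _ _ (by omega) (by omega),
    entry_pathFlow_snd _ _ _ _ (by omega) (by omega)]
  simp only [Prod.ext_iff, Pi.zero_apply]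
  by_cases hy : z.1 = y.1 <;> by_cases hx : z.2 = x.2 <;>
    simp only [hx, hy, if_true, if_false, true_and, false_and, and_true, and_false] at hv hh ⊢ <;>
    linarith

theorem flowL1_pathFlow_le {n m : ℕ} (x y : Fin n × Fin m) :
    flowL1 (pathFlow x y) ≤ gd x y := by
  have hh := sum_abs_crossing_le (m - 1) x.2 y.2
  have hv := sum_abs_crossing_le (n - 1) x.1 y.1
  simp only [flowL1, pathFlow, gd, apply_ite abs, abs_zero]
  rw [Finset.sum_comm]
  simp only [Finset.sum_ite_eq', Finset.mem_univ, if_true]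
  push_cast at hh hv ⊢
  linarith

/-- Adding the path flows weighted by a coupling of `μ` and `ν` turns a flow producing `μ` into
one producing `ν`. -/
theorem applyFlow_add_coupling {n m : ℕ} {R μ ν : Fin n × Fin m → ℝ} {δ : Flow n m}
    (hδ : applyFlow R δ = μ) {π : (Fin n × Fin m) × (Fin n × Fin m) → ℝ}
    (hπ : IsCoupling μ ν π) :
    applyFlow R (δ + ∑ p, π p • pathFlow p.1 p.2) = ν := by
  funext z
  rw [applyFlow_add_sum_smul, hδ]
  simp only [applyFlow_zero_pathFlow, mul_sub, Finset.sum_sub_distrib]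
  have hν : ∑ p : (Fin n × Fin m) × (Fin n × Fin m), π p * (if z = p.2 then 1 else 0) = ν z := by
    rw [Fintype.sum_prod_type, ← hπ.2.2 z]
    simp
  have hμ : ∑ p : (Fin n × Fin m) × (Fin n × Fin m), π p * (if z = p.1 then 1 else 0) = μ z := by
    rw [Fintype.sum_prod_type_right, ← hπ.2.1 z]
    simp
  rw [hν, hμ]
  ring

theorem isCoupling_mul {n m : ℕ} {μ ν : Fin n × Fin m → ℝ} (hμ : IsProbDist μ)
    (hν : IsProbDist ν) : IsCoupling μ ν fun p => μ p.1 * ν p.2 :=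
  ⟨fun p => mul_nonneg (hμ.1 _) (hν.1 _),
    fun x => by simp [← Finset.mul_sum, hν.2],
    fun y => by simp [← Finset.sum_mul, hμ.2]⟩

/-- Certification in the flow domain: if `F̃(δ) = F̃(δ^μ)` for every flow `δ` with
`‖δ − δ^μ‖₁ < ε`, then `F(ν) = F(μ)` for every probability distribution `ν` with
`W₁(μ, ν) < ε`. -/
theorem certification_in_flow_domain {α : Type*} (n m : ℕ)
    (F : (Fin n × Fin m → ℝ) → α)
    (R μ : Fin n × Fin m → ℝ) (hR : IsProbDist R) (hμ : IsProbDist μ)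
    (δμ : Flow n m) (hδμ : applyFlow R δμ = μ)
    (ε : ℝ) (hε : 0 < ε)
    (hcert : ∀ δ : Flow n m, flowL1 (δ - δμ) < ε →
      F (applyFlow R δ) = F (applyFlow R δμ)) :
    ∀ ν : Fin n × Fin m → ℝ, IsProbDist ν → W1 μ ν < ε → F ν = F μ := by
  intro ν hν hW
  obtain ⟨_, ⟨π, hπ, rfl⟩, hcost⟩ :=
    exists_lt_of_csInf_lt (by exact ⟨_, _, isCoupling_mul hμ hν, rfl⟩) hW
  have hF := hcert (δμ + ∑ p, π p • pathFlow p.1 p.2) <| by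
    rw [add_sub_cancel_left]
    refine ((flowL1_sum_smul_le _ _ _).trans (Finset.sum_le_sum fun p _ => ?_)).trans_lt hcost
    rw [abs_of_nonneg (hπ.1 p), mul_comm]
    exact mul_le_mul_of_nonneg_right (flowL1_pathFlow_le _ _) (hπ.1 p)
  rwa [applyFlow_add_coupling hδμ hπ, hδμ] at hF

end WassersteinFlow
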